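/- Let {(yᵢ, xᵢ)}_{i=1}^k (k ≥ 1) be i.i.d. samples from P^b(μ₀, μ₁, Λ), and set μ = μ₁ − μ₀ and u = 2(μ₁ + μ₀). Then the law of the decision statistic p = (2/k) Σ_{i=1}^k xᵢ yᵢ equals the law of μ + h·u + g, where h = K/k − 1/2 with K ~ Binomial(k, 1/2), g is a Gaussian vector with mean 0 and covariance (4/k)Λ, and K and g are independent. -/

import Mathlib

open MeasureTheory ProbabilityTheory Matrix
open scoped ENNReal

noncomputable section

/-- Density of the `d`-dimensional Gaussian `N(μ, Λ)`. -/
def gaussianPdf (d : ℕ) (μ : Fin d → ℝ) (Λ : Matrix (Fin d) (Fin d) ℝ) (y : Fin d → ℝ) : ℝ :=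
  (Real.sqrt ((2 * Real.pi) ^ d * Λ.det))⁻¹ *
    Real.exp (-((y - μ) ⬝ᵥ (Λ⁻¹ *ᵥ (y - μ))) / 2)

/-- The `d`-dimensional Gaussian measure `N(μ, Λ)`. -/
def gaussianMeasure (d : ℕ) (μ : Fin d → ℝ) (Λ : Matrix (Fin d) (Fin d) ℝ) :
    Measure (Fin d → ℝ) :=
  volume.withDensity fun y => ENNReal.ofReal (gaussianPdf d μ Λ y)

/-- The joint law `P^b(μ₀, μ₁, Λ)` of a pair `(y, x)`: `x = ±1` with probability `1/2` each,
and conditionally on `x = -1` (resp. `x = 1`), `y ~ N(μ₀, Λ)` (resp. `N(μ₁, Λ)`). -/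
def Pb (d : ℕ) (μ₀ μ₁ : Fin d → ℝ) (Λ : Matrix (Fin d) (Fin d) ℝ) :
    Measure ((Fin d → ℝ) × ℝ) :=
  (2 : ℝ≥0∞)⁻¹ • (gaussianMeasure d μ₀ Λ).prod (Measure.dirac (-1 : ℝ)) +
    (2 : ℝ≥0∞)⁻¹ • (gaussianMeasure d μ₁ Λ).prod (Measure.dirac (1 : ℝ))

/-- The binomial distribution with `k` trials and success probability `1/2`,
as a measure on `ℕ`. -/
def binomialHalf (k : ℕ) : Measure ℕ :=
  ((PMF.binomial 2⁻¹ (by norm_num) k).map (fun i => (i : ℕ))).toMeasure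

lemma gaussianPdf_nonneg (d : ℕ) (m : Fin d → ℝ) (Λ : Matrix (Fin d) (Fin d) ℝ) (y : Fin d → ℝ) :
    0 ≤ gaussianPdf d m Λ y := by
  unfold gaussianPdf; positivity

lemma continuous_gaussianPdf (d : ℕ) (m : Fin d → ℝ) (Λ : Matrix (Fin d) (Fin d) ℝ) :
    Continuous (gaussianPdf d m Λ) := by
  unfold gaussianPdf; fun_prop

lemma integral_gaussianMeasure (d : ℕ) (m : Fin d → ℝ) (Λ : Matrix (Fin d) (Fin d) ℝ)
    (f : (Fin d → ℝ) → ℂ) :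
    ∫ y, f y ∂gaussianMeasure d m Λ = ∫ y, (gaussianPdf d m Λ y : ℂ) * f y := by
  unfold gaussianMeasure
  rw [integral_withDensity_eq_integral_toReal_smul
    (continuous_gaussianPdf d m Λ).measurable.ennreal_ofReal (by simp)]
  simp [ENNReal.toReal_ofReal (gaussianPdf_nonneg d m Λ _)]

lemma volume_eq_smul_map_toLin' {d : ℕ} {A : Matrix (Fin d) (Fin d) ℝ} (hA : A.det ≠ 0) :
    (volume : Measure (Fin d → ℝ)) =
      ENNReal.ofReal |A.det| • Measure.map (toLin' A) volume := by
  rw [Real.map_matrix_volume_pi_eq_smul_volume_pi hA, smul_smul,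
    ← ENNReal.ofReal_mul (abs_nonneg _), ← abs_mul, mul_inv_cancel₀ hA]
  simp

lemma integral_comp_affine {d : ℕ} {A : Matrix (Fin d) (Fin d) ℝ} (hA : A.det ≠ 0)
    (m : Fin d → ℝ) {f : (Fin d → ℝ) → ℂ} (hf : Continuous f) :
    ∫ y, f y = |A.det| * ∫ z, f (A *ᵥ z + m) := by
  rw [← integral_add_right_eq_self f m]
  conv_lhs => rw [volume_eq_smul_map_toLin' hA]
  have hL : Continuous (toLin' A) := (toLin' A).continuous_of_finiteDimensional
  rw [integral_smul_measure, integral_map hL.aemeasurable (by fun_prop)]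
  simp [toLin'_apply]

lemma gaussianPdf_affine {d : ℕ} {A : Matrix (Fin d) (Fin d) ℝ} (hA : A.det ≠ 0)
    (m z : Fin d → ℝ) :
    |A.det| * gaussianPdf d m (A * Aᵀ) (A *ᵥ z + m) =
      (Real.sqrt ((2 * Real.pi) ^ d))⁻¹ * Real.exp (-(z ⬝ᵥ z) / 2) := by
  have hq : (A *ᵥ z) ⬝ᵥ ((A * Aᵀ)⁻¹ *ᵥ (A *ᵥ z)) = z ⬝ᵥ z := by
    have : IsUnit A.det := hA.isUnit
    rw [Matrix.mul_inv_rev, mulVec_mulVec, Matrix.mul_assoc, nonsing_inv_mul _ this, Matrix.mul_one,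
      dotProduct_mulVec, ← vecMul_transpose, vecMul_vecMul, mul_nonsing_inv _ (by simpa using this),
      vecMul_one]
  have hd : |A.det| ≠ 0 := abs_ne_zero.mpr hA
  rw [gaussianPdf, add_sub_cancel_right, hq, det_mul, det_transpose, ← sq,
    Real.sqrt_mul (by positivity), Real.sqrt_sq_eq_abs]
  field_simp

open scoped MatrixOrder in
lemma integral_cexp_gaussianMeasure (d : ℕ) (m t : Fin d → ℝ) {Λ : Matrix (Fin d) (Fin d) ℝ}
    (hΛ : Λ.PosDef) :
    ∫ y, Complex.exp (((t ⬝ᵥ y : ℝ) : ℂ) * Complex.I) ∂gaussianMeasure d m Λ =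
      Complex.exp (((t ⬝ᵥ m : ℝ) : ℂ) * Complex.I - ((t ⬝ᵥ (Λ *ᵥ t) : ℝ) : ℂ) / 2) := by
  obtain ⟨B, rfl⟩ := CStarAlgebra.nonneg_iff_eq_star_mul_self.mp hΛ.posSemidef.nonneg
  have hB : B.det ≠ 0 := by
    intro h
    have := hΛ.det_pos
    simp [h] at this
  set A := Bᵀ
  have hA : A.det ≠ 0 := by simpa [A] using hB
  have hBA : star B * B = A * Aᵀ := by simp [A, star_eq_conjTranspose]
  rw [hBA, integral_gaussianMeasure, integral_comp_affine hA m (by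
    have := continuous_gaussianPdf d m (A * Aᵀ)
    fun_prop), ← integral_const_mul]
  have key (z : Fin d → ℝ) : ((|A.det| : ℝ) : ℂ) * ((gaussianPdf d m (A * Aᵀ) (A *ᵥ z + m) : ℂ) *
      Complex.exp (((t ⬝ᵥ (A *ᵥ z + m) : ℝ) : ℂ) * Complex.I)) =
      ((Real.sqrt ((2 * Real.pi) ^ d))⁻¹ * Complex.exp (((t ⬝ᵥ m : ℝ) : ℂ) * Complex.I)) *
      Complex.exp (-(1 / 2 : ℂ) * ∑ i, (z i : ℂ) ^ 2 +
        ∑ i, (Complex.I * ((t ᵥ* A) i : ℂ)) * z i) := by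
    rw [← mul_assoc, ← Complex.ofReal_mul, gaussianPdf_affine hA, dotProduct_add,
      dotProduct_mulVec]
    push_cast
    rw [mul_assoc, mul_assoc, ← Complex.exp_add, ← Complex.exp_add]
    congr 2
    simp only [dotProduct, Complex.ofReal_sum, Complex.ofReal_mul, Complex.ofReal_pow, ← sq, mul_assoc,
      ← Finset.mul_sum]
    ring
  simp_rw [key]
  rw [integral_const_mul, GaussianFourier.integral_cexp_neg_mul_sum_add (by norm_num)]
  have hq : t ⬝ᵥ ((A * Aᵀ) *ᵥ t) = ∑ i, (t ᵥ* A) i ^ 2 := by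
    rw [← mulVec_mulVec, dotProduct_mulVec, mulVec_transpose]
    simp [dotProduct, sq]
  have hc : ((Real.pi : ℂ) / (1 / 2)) ^ (Fintype.card (Fin d) / 2 : ℂ) =
      (Real.sqrt ((2 * Real.pi) ^ d) : ℂ) := by
    rw [Real.sqrt_eq_rpow, ← Real.rpow_natCast, ← Real.rpow_mul (by positivity),
      Complex.ofReal_cpow (by positivity)]
    push_cast
    congr 1
    · ring
    · simp; ring
  have hs : (Real.sqrt ((2 * Real.pi) ^ d) : ℂ) ≠ 0 := by
    rw [Complex.ofReal_ne_zero]; positivity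
  rw [hc, hq]
  push_cast
  rw [mul_mul_mul_comm, inv_mul_cancel₀ hs, one_mul, ← Complex.exp_add]
  congr 1
  simp only [mul_pow, Complex.I_sq, ← Finset.mul_sum]
  ring

lemma isProbabilityMeasure_gaussianMeasure (d : ℕ) (m : Fin d → ℝ)
    {Λ : Matrix (Fin d) (Fin d) ℝ} (hΛ : Λ.PosDef) :
    IsProbabilityMeasure (gaussianMeasure d m Λ) := by
  have h := integral_cexp_gaussianMeasure d m 0 hΛ
  simp only [zero_dotProduct, Complex.ofReal_zero, zero_mul, Complex.exp_zero, integral_const,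
    zero_div, sub_zero] at h
  refine ⟨?_⟩
  have h1 : (gaussianMeasure d m Λ).real Set.univ = 1 := by simpa using h
  rwa [measureReal_def, ENNReal.toReal_eq_one_iff] at h1

lemma integral_Pb (d : ℕ) (μ₀ μ₁ : Fin d → ℝ) {Λ : Matrix (Fin d) (Fin d) ℝ} (hΛ : Λ.PosDef)
    (t : Fin d → ℝ) :
    ∫ s, Complex.exp (((t ⬝ᵥ (s.2 • s.1) : ℝ) : ℂ) * Complex.I) ∂Pb d μ₀ μ₁ Λ =
      Complex.exp (-((t ⬝ᵥ (Λ *ᵥ t) : ℝ) : ℂ) / 2) *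
        ((Complex.exp (-((t ⬝ᵥ μ₀ : ℝ) : ℂ) * Complex.I) +
          Complex.exp (((t ⬝ᵥ μ₁ : ℝ) : ℂ) * Complex.I)) / 2) := by
  have := isProbabilityMeasure_gaussianMeasure d μ₀ hΛ
  have := isProbabilityMeasure_gaussianMeasure d μ₁ hΛ
  have hcont : Continuous fun s : (Fin d → ℝ) × ℝ =>
      Complex.exp (((t ⬝ᵥ (s.2 • s.1) : ℝ) : ℂ) * Complex.I) := by fun_prop
  have hint (ν : Measure ((Fin d → ℝ) × ℝ)) [IsFiniteMeasure ν] : Integrable (fun s =>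
      Complex.exp (((t ⬝ᵥ (s.2 • s.1) : ℝ) : ℂ) * Complex.I)) ν :=
    Integrable.of_bound hcont.aestronglyMeasurable 1
      (ae_of_all _ fun s => (Complex.norm_exp_ofReal_mul_I _).le)
  have hsmul (ν : Measure ((Fin d → ℝ) × ℝ)) [IsFiniteMeasure ν] := (hint ν).smul_measure
    (c := (2 : ℝ≥0∞)⁻¹) (by simp)
  have hdirac (m : Fin d → ℝ) (x : ℝ) : ∫ s, Complex.exp (((t ⬝ᵥ (s.2 • s.1) : ℝ) : ℂ) * Complex.I)
      ∂(gaussianMeasure d m Λ).prod (Measure.dirac x) =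
      Complex.exp (((t ⬝ᵥ m * x : ℝ) : ℂ) * Complex.I -
        ((x ^ 2 * t ⬝ᵥ (Λ *ᵥ t) : ℝ) : ℂ) / 2) := by
    have := isProbabilityMeasure_gaussianMeasure d m hΛ
    rw [integral_prod _ (hint _)]
    simp only [integral_dirac]
    have h := integral_cexp_gaussianMeasure d m (x • t) hΛ
    simp only [smul_dotProduct, mulVec_smul, dotProduct_smul, smul_eq_mul] at h ⊢
    rw [h]
    congr 4 <;> ring
  rw [Pb, integral_add_measure (hsmul _) (hsmul _), integral_smul_measure, integral_smul_measure,
    hdirac, hdirac]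
  simp only [ENNReal.toReal_inv, ENNReal.toReal_ofNat, Complex.real_smul, sub_eq_add_neg,
    Complex.exp_add]
  push_cast
  ring_nf

lemma isProbabilityMeasure_Pb (d : ℕ) (μ₀ μ₁ : Fin d → ℝ) {Λ : Matrix (Fin d) (Fin d) ℝ}
    (hΛ : Λ.PosDef) : IsProbabilityMeasure (Pb d μ₀ μ₁ Λ) := by
  have := isProbabilityMeasure_gaussianMeasure d μ₀ hΛ
  have := isProbabilityMeasure_gaussianMeasure d μ₁ hΛ
  refine ⟨?_⟩
  simp [Pb, ENNReal.inv_two_add_inv_two]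

instance isProbabilityMeasure_binomialHalf (k : ℕ) : IsProbabilityMeasure (binomialHalf k) := by
  unfold binomialHalf; infer_instance

lemma integral_pow_binomialHalf (k : ℕ) (z : ℂ) :
    ∫ n, z ^ n ∂binomialHalf k = ((1 + z) / 2) ^ k := by
  have h : binomialHalf k = Measure.map (fun i : Fin (k + 1) => (i : ℕ))
      (PMF.binomial 2⁻¹ (by norm_num) k).toMeasure := by
    rw [PMF.toMeasure_map _ _ (by fun_prop)]
    exact congrArg PMF.toMeasure (PMF.map_id _)
  rw [h, integral_map (by fun_prop) (by fun_prop), PMF.integral_eq_sum, div_pow, add_comm 1 z,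
    add_pow, Finset.sum_div, Finset.sum_range]
  refine Finset.sum_congr rfl fun i _ => ?_
  have hi : (i : ℕ) + (k - i) = k := by lia
  have hp : (2 : ℂ)⁻¹ ^ (i : ℕ) * 2⁻¹ ^ (k - i) = (2 ^ k)⁻¹ := by
    rw [← pow_add, hi, inv_pow]
  rw [PMF.binomial_apply]
  simp [ENNReal.one_sub_inv_two, -inv_pow]
  rw [hp]
  ring

/-- For `k` i.i.d. samples from `P^b(μ₀, μ₁, Λ)` and `μ = μ₁ - μ₀`,
`u = 2(μ₁ + μ₀)`, the law of `p = (2/k) ∑ᵢ xᵢ yᵢ` equals the law of `μ + h·u + g` where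
`h = K/k - 1/2` with `K ~ Binomial(k, 1/2)`, `g ~ N(0, (4/k)Λ)`, and `K`, `g` independent. -/
theorem stmt5 (d k : ℕ) (hk : 1 ≤ k) (μ₀ μ₁ : Fin d → ℝ)
    (Λ : Matrix (Fin d) (Fin d) ℝ) (hΛ : Λ.PosDef) :
    Measure.map (fun s : Fin k → (Fin d → ℝ) × ℝ => ((2 : ℝ) / k) • ∑ i, (s i).2 • (s i).1)
        (Measure.pi fun _ : Fin k => Pb d μ₀ μ₁ Λ) =
      Measure.map
        (fun Kg : ℕ × (Fin d → ℝ) =>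
          (μ₁ - μ₀) + ((Kg.1 : ℝ) / k - 1 / 2) • ((2 : ℝ) • (μ₁ + μ₀)) + Kg.2)
        ((binomialHalf k).prod (gaussianMeasure d 0 (((4 : ℝ) / k) • Λ))) := by
  have hk0 : (0 : ℝ) < k := by exact_mod_cast hk
  have hΛ' : (((4 : ℝ) / k) • Λ).PosDef := hΛ.smul (by positivity)
  have := isProbabilityMeasure_gaussianMeasure d 0 hΛ'
  have := isProbabilityMeasure_Pb d μ₀ μ₁ hΛ
  have hmeas : Measurable fun Kg : ℕ × (Fin d → ℝ) =>
      (μ₁ - μ₀) + ((Kg.1 : ℝ) / k - 1 / 2) • ((2 : ℝ) • (μ₁ + μ₀)) + Kg.2 := by fun_prop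
  have hmeas' : Measurable fun s : Fin k → (Fin d → ℝ) × ℝ =>
      ((2 : ℝ) / k) • ∑ i, (s i).2 • (s i).1 := by fun_prop
  refine Measure.ext_of_charFunDual (funext fun L => ?_)
  obtain ⟨t, ht⟩ : ∃ t : Fin d → ℝ, ∀ y, L y = t ⬝ᵥ y := by
    refine ⟨fun i => L (Pi.single i 1), fun y => ?_⟩
    conv_lhs => rw [pi_eq_sum_univ' y]
    simp [dotProduct, mul_comm]
  simp only [charFunDual_apply, ht]
  rw [integral_map hmeas'.aemeasurable (by fun_prop), integral_map hmeas.aemeasurable (by fun_prop)]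
  have hl (s : Fin k → (Fin d → ℝ) × ℝ) :
      Complex.exp (((t ⬝ᵥ (((2 : ℝ) / k) • ∑ i, (s i).2 • (s i).1) : ℝ) : ℂ) * Complex.I) =
      ∏ i, Complex.exp ((((((2 : ℝ) / k) • t) ⬝ᵥ ((s i).2 • (s i).1) : ℝ) : ℂ) * Complex.I) := by
    rw [← Complex.exp_sum, ← Finset.sum_mul, ← Complex.ofReal_sum, ← dotProduct_sum,
      smul_dotProduct, dotProduct_smul]
  have hr (Kg : ℕ × (Fin d → ℝ)) : Complex.exp (((t ⬝ᵥ ((μ₁ - μ₀) + ((Kg.1 : ℝ) / k - 1 / 2) •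
      ((2 : ℝ) • (μ₁ + μ₀)) + Kg.2) : ℝ) : ℂ) * Complex.I) =
      (Complex.exp (((-2 * t ⬝ᵥ μ₀ : ℝ) : ℂ) * Complex.I) *
        Complex.exp (((2 / k * (t ⬝ᵥ μ₀ + t ⬝ᵥ μ₁) : ℝ) : ℂ) * Complex.I) ^ Kg.1) *
      Complex.exp (((t ⬝ᵥ Kg.2 : ℝ) : ℂ) * Complex.I) := by
    rw [← Complex.exp_nat_mul, ← Complex.exp_add, ← Complex.exp_add]
    simp only [dotProduct_add, dotProduct_sub, dotProduct_smul, smul_eq_mul]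
    congr 1
    push_cast
    ring
  simp_rw [hl, hr]
  rw [integral_fintype_prod_eq_prod (fun _ : Fin k => fun s : (Fin d → ℝ) × ℝ =>
      Complex.exp ((((((2 : ℝ) / k) • t) ⬝ᵥ (s.2 • s.1) : ℝ) : ℂ) * Complex.I)),
    integral_prod_mul (fun n : ℕ => Complex.exp (((-2 * t ⬝ᵥ μ₀ : ℝ) : ℂ) * Complex.I) *
      Complex.exp (((2 / k * (t ⬝ᵥ μ₀ + t ⬝ᵥ μ₁) : ℝ) : ℂ) * Complex.I) ^ n)
      (fun y => Complex.exp (((t ⬝ᵥ y : ℝ) : ℂ) * Complex.I)),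
    integral_const_mul, integral_pow_binomialHalf, integral_cexp_gaussianMeasure d 0 t hΛ',
    integral_Pb d μ₀ μ₁ hΛ, Finset.prod_const, Finset.card_univ, Fintype.card_fin]
  have hkc : (k : ℂ) ≠ 0 := by exact_mod_cast hk0.ne'
  have h₁ : Complex.exp (((-2 * t ⬝ᵥ μ₀ : ℝ) : ℂ) * Complex.I) =
      Complex.exp (((-(2 / k) * t ⬝ᵥ μ₀ : ℝ) : ℂ) * Complex.I) ^ k := by
    rw [← Complex.exp_nat_mul]
    congr 1
    push_cast
    field_simp
  have h₂ : Complex.exp (((t ⬝ᵥ (0 : Fin d → ℝ) : ℝ) : ℂ) * Complex.I -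
      ((t ⬝ᵥ ((((4 : ℝ) / k) • Λ) *ᵥ t) : ℝ) : ℂ) / 2) =
      Complex.exp (-(((((2 : ℝ) / k) • t) ⬝ᵥ (Λ *ᵥ (((2 : ℝ) / k) • t)) : ℝ) : ℂ) / 2) ^ k := by
    rw [← Complex.exp_nat_mul]
    congr 1
    simp only [dotProduct_zero, smul_mulVec, mulVec_smul, smul_dotProduct, dotProduct_smul,
      smul_eq_mul]
    push_cast
    field_simp
    ring
  rw [h₁, h₂, ← mul_pow, ← mul_pow, mul_comm (Complex.exp (-_ / 2))]
  congr 2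
  rw [← mul_div_assoc, mul_add, mul_one, ← Complex.exp_add]
  simp only [smul_dotProduct, smul_eq_mul]
  congr 3
  · push_cast; ring
  · push_cast; ring
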